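/- (Monotonicity of the 2D fourth-order scheme.) Set a = (h/(2μ))·‖(u,v)‖_∞. If a < (√201 − 11)/16 and Δt·μ/h² ≥ (2a + 1)/(5/2 − 11a − 8a²) (equivalently c ≤ (5/2 − 11a − 8a²)/(2a + 1)), then the scaled 2D fourth-order scheme operator A is bijective and its inverse maps entrywise-nonnegative arrays to entrywise-nonnegative arrays; equivalently, the unscaled scheme operator L̄ = (1/c)A is inverse-positive. In particular these hypotheses hold whenever h·‖(u,v)‖_∞/μ ≤ 1/3 and Δt·μ/h² ≥ 3. -/

import Mathlib

/-- The value of a grid array at a pair of natural indices (`0` outside the grid;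
inside the grid all index arithmetic of the scheme stays in range). -/
noncomputable def gridVal (nx ny : ℕ) (φ : Fin (nx + 2) → Fin (ny + 2) → ℝ)
    (i j : ℕ) : ℝ :=
  if hi : i < nx + 2 then if hj : j < ny + 2 then φ ⟨i, hi⟩ ⟨j, hj⟩ else 0 else 0

/-- `(i,j)` is a boundary index of the `(nx+2) × (ny+2)` grid. -/
def isBdry (nx ny i j : ℕ) : Prop := i = 0 ∨ i = nx + 1 ∨ j = 0 ∨ j = ny + 1

instance (nx ny i j : ℕ) : Decidable (isBdry nx ny i j) := by
  unfold isBdry; infer_instance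

/-- The scaled 2D fourth-order scheme operator `A = (h²/(μΔt))·L̄` with `c = h²/(μΔt)`:
`(Aφ)ᵢⱼ = c·φᵢⱼ` at boundary indices; at interior indices the fourth-order finite
difference discretization of `c + (h²/μ)(u∂ₓ + v∂_y - μΔ)` obtained from the `Q²`
spectral element method, with the cell-center, x-edge-center, y-edge-center and knot
stencils depending on the parities of `i` and `j`. -/
noncomputable def schemeA2D (nx ny : ℕ) (h μ Δt : ℝ) (u v : ℕ → ℕ → ℝ)
    (φ : Fin (nx + 2) → Fin (ny + 2) → ℝ) (I : Fin (nx + 2)) (J : Fin (ny + 2)) : ℝ :=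
  let c := h ^ 2 / (μ * Δt)
  let i := (I : ℕ)
  let j := (J : ℕ)
  let ψ := gridVal nx ny φ
  if isBdry nx ny i j then c * φ I J
  else if Odd i ∧ Odd j then
    -- cell center
    c * ψ i j + h * u i j / (2 * μ) * (ψ (i + 1) j - ψ (i - 1) j)
      + h * v i j / (2 * μ) * (ψ i (j + 1) - ψ i (j - 1))
      + (-ψ (i - 1) j + 2 * ψ i j - ψ (i + 1) j)
      + (-ψ i (j - 1) + 2 * ψ i j - ψ i (j + 1))
  else if Odd i then
    -- x-edge center (edge parallel to the x-axis): `i` odd, `j` even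
    c * ψ i j + h * u i j / (2 * μ) * (ψ (i + 1) j - ψ (i - 1) j)
      + h * v i j / (4 * μ) * (ψ i (j - 2) - 4 * ψ i (j - 1) + 4 * ψ i (j + 1) - ψ i (j + 2))
      + (-ψ (i - 1) j + 2 * ψ i j - ψ (i + 1) j)
      + (ψ i (j - 2) - 8 * ψ i (j - 1) + 14 * ψ i j - 8 * ψ i (j + 1) + ψ i (j + 2)) / 4
  else if Odd j then
    -- y-edge center (edge parallel to the y-axis): `i` even, `j` odd
    c * ψ i j + h * u i j / (4 * μ) * (ψ (i - 2) j - 4 * ψ (i - 1) j + 4 * ψ (i + 1) j - ψ (i + 2) j)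
      + h * v i j / (2 * μ) * (ψ i (j + 1) - ψ i (j - 1))
      + (ψ (i - 2) j - 8 * ψ (i - 1) j + 14 * ψ i j - 8 * ψ (i + 1) j + ψ (i + 2) j) / 4
      + (-ψ i (j - 1) + 2 * ψ i j - ψ i (j + 1))
  else
    -- interior knot: `i` and `j` both even
    c * ψ i j + h * u i j / (4 * μ) * (ψ (i - 2) j - 4 * ψ (i - 1) j + 4 * ψ (i + 1) j - ψ (i + 2) j)
      + h * v i j / (4 * μ) * (ψ i (j - 2) - 4 * ψ i (j - 1) + 4 * ψ i (j + 1) - ψ i (j + 2))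
      + (ψ (i - 2) j - 8 * ψ (i - 1) j + 14 * ψ i j - 8 * ψ (i + 1) j + ψ (i + 2) j) / 4
      + (ψ i (j - 2) - 8 * ψ i (j - 1) + 14 * ψ i j - 8 * ψ i (j + 1) + ψ i (j + 2)) / 4

/-- One-dimensional stencil at a cell midpoint. -/
noncomputable def midStencil (α l x r : ℝ) : ℝ := α * (r - l) + (-l + 2 * x - r)

/-- One-dimensional stencil at a cell endpoint. -/
noncomputable def endStencil (α ll l x r rr : ℝ) : ℝ :=
  α / 2 * (ll - 4 * l + 4 * r - rr) + (ll - 8 * l + 14 * x - 8 * r + rr) / 4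

/-- A far neighbour of a cell endpoint is dominated by the midpoint in between. -/
theorem far_le_near {a d α α' x y : ℝ} (ha : a < 1 / 4) (hd : 0 < d)
    (hda : d * (1 + 2 * a) ≤ 8 * (1 - a ^ 2)) (hα : |α| ≤ a) (hα' : |α'| ≤ a) (hy : 0 ≤ y)
    (hxy : (1 - α') * y ≤ d * x) : (1 / 4 - α / 2) * y ≤ (2 - 2 * α) * x := by
  have ha0 : 0 ≤ a := (abs_nonneg _).trans hα
  obtain ⟨h1, h2⟩ := abs_le.mp hα
  obtain ⟨h3, h4⟩ := abs_le.mp hα'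
  have hcoef : (1 / 4 - α / 2) * d ≤ (2 - 2 * α) * (1 - a) := by
    have e1 : (1 / 4 - α / 2) * (d * (1 + 2 * a)) ≤ (1 / 4 - α / 2) * (8 * (1 - a ^ 2)) :=
      mul_le_mul_of_nonneg_left hda (by linarith)
    have e2 : 0 ≤ (1 - a) * (a + α) := mul_nonneg (by linarith) (by linarith)
    refine le_of_mul_le_mul_right (a := 1 + 2 * a) ?_ (by linarith)
    linarith
  have e3 : (1 / 4 - α / 2) * d * y ≤ (2 - 2 * α) * (1 - a) * y :=
    mul_le_mul_of_nonneg_right hcoef hy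
  have e4 : (1 - a) * y ≤ (1 - α') * y := mul_le_mul_of_nonneg_right (by linarith) hy
  have e5 : (2 - 2 * α) * ((1 - a) * y) ≤ (2 - 2 * α) * (d * x) :=
    mul_le_mul_of_nonneg_left (e4.trans hxy) (by linarith)
  refine le_of_mul_le_mul_left (a := d) ?_ hd
  linarith

theorem midStencil_le {a α l x r : ℝ} (ha : a < 1 / 4) (hα : |α| ≤ a) (hl : 0 ≤ l)
    (hr : 0 ≤ r) : midStencil α l x r ≤ 2 * x - (1 - α) * r ∧
      midStencil α l x r ≤ 2 * x - (1 + α) * l ∧ midStencil α l x r ≤ 2 * x := by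
  obtain ⟨h1, h2⟩ := abs_le.mp hα
  have e1 : 0 ≤ (1 - α) * r := mul_nonneg (by linarith) hr
  have e2 : 0 ≤ (1 + α) * l := mul_nonneg (by linarith) hl
  unfold midStencil
  refine ⟨?_, ?_, ?_⟩ <;> linarith

theorem endStencil_le {a d α αl αr ll l x r rr : ℝ} (ha : a < 1 / 4) (hd : 0 < d)
    (hda : d * (1 + 2 * a) ≤ 8 * (1 - a ^ 2)) (hα : |α| ≤ a) (hαl : |αl| ≤ a) (hαr : |αr| ≤ a)
    (hll : 0 ≤ ll) (hrr : 0 ≤ rr) (hl : (1 + αl) * ll ≤ d * l) (hr : (1 - αr) * rr ≤ d * r) :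
    endStencil α ll l x r rr ≤ 7 / 2 * x := by
  have e1 := far_le_near ha hd hda hα hαr hrr hr
  have e2 := far_le_near (α := -α) (α' := -αl) (x := l) ha hd hda (by rwa [abs_neg])
    (by rwa [abs_neg]) hll (by linarith)
  unfold endStencil
  linarith

theorem exists_even_add_two {n i : ℕ} (hn : Odd n) (hi : Even i) (h1 : 1 ≤ i) (h : i ≤ n) :
    ∃ k, i = k + 2 ∧ Even k ∧ k + 2 < n :=
  ⟨i - 2, by grind, by grind, by grind⟩

theorem exists_even_add_one {n i : ℕ} (hi : Odd i) (h : i ≤ n) :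
    ∃ k, i = k + 1 ∧ Even k ∧ k < n :=
  ⟨i - 1, by grind, by grind, by grind⟩

/-- A nonnegative array whose image under the scheme is positive at interior indices is positive
there. -/
theorem interior_pos {nx ny : ℕ} (hnx : Odd nx) (hny : Odd ny) {c a : ℝ} (hc : 0 < c)
    (ha0 : 0 ≤ a) (ha : a < 1 / 4) (hca : (c + 11 / 2) * (1 + 2 * a) ≤ 8 * (1 - a ^ 2))
    {α β ψ : ℕ → ℕ → ℝ}
    (hα : ∀ i j, 1 ≤ i → i ≤ nx → 1 ≤ j → j ≤ ny → |α i j| ≤ a)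
    (hβ : ∀ i j, 1 ≤ i → i ≤ nx → 1 ≤ j → j ≤ ny → |β i j| ≤ a)
    (hψ : ∀ i j, i ≤ nx + 1 → j ≤ ny + 1 → 0 ≤ ψ i j)
    (hcc : ∀ i j, Even i → Even j → i < nx → j < ny → 0 < c * ψ (i + 1) (j + 1)
      + midStencil (α (i + 1) (j + 1)) (ψ i (j + 1)) (ψ (i + 1) (j + 1)) (ψ (i + 2) (j + 1))
      + midStencil (β (i + 1) (j + 1)) (ψ (i + 1) j) (ψ (i + 1) (j + 1)) (ψ (i + 1) (j + 2)))
    (hxe : ∀ i j, Even i → Even j → i < nx → j + 2 < ny → 0 < c * ψ (i + 1) (j + 2)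
      + midStencil (α (i + 1) (j + 2)) (ψ i (j + 2)) (ψ (i + 1) (j + 2)) (ψ (i + 2) (j + 2))
      + endStencil (β (i + 1) (j + 2)) (ψ (i + 1) j) (ψ (i + 1) (j + 1)) (ψ (i + 1) (j + 2))
        (ψ (i + 1) (j + 3)) (ψ (i + 1) (j + 4)))
    (hye : ∀ i j, Even i → Even j → i + 2 < nx → j < ny → 0 < c * ψ (i + 2) (j + 1)
      + endStencil (α (i + 2) (j + 1)) (ψ i (j + 1)) (ψ (i + 1) (j + 1)) (ψ (i + 2) (j + 1))
        (ψ (i + 3) (j + 1)) (ψ (i + 4) (j + 1))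
      + midStencil (β (i + 2) (j + 1)) (ψ (i + 2) j) (ψ (i + 2) (j + 1)) (ψ (i + 2) (j + 2)))
    (hkn : ∀ i j, Even i → Even j → i + 2 < nx → j + 2 < ny → 0 < c * ψ (i + 2) (j + 2)
      + endStencil (α (i + 2) (j + 2)) (ψ i (j + 2)) (ψ (i + 1) (j + 2)) (ψ (i + 2) (j + 2))
        (ψ (i + 3) (j + 2)) (ψ (i + 4) (j + 2))
      + endStencil (β (i + 2) (j + 2)) (ψ (i + 2) j) (ψ (i + 2) (j + 1)) (ψ (i + 2) (j + 2))
        (ψ (i + 2) (j + 3)) (ψ (i + 2) (j + 4)))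
    (i j : ℕ) (hi1 : 1 ≤ i) (hi : i ≤ nx) (hj1 : 1 ≤ j) (hj : j ≤ ny) : 0 < ψ i j := by
  have hca' : (c + 4) * (1 + 2 * a) ≤ 8 * (1 - a ^ 2) := by linarith
  have center : ∀ i j, Even i → Even j → i < nx → j < ny →
      0 < (c + 4) * ψ (i + 1) (j + 1) ∧
      (1 + α (i + 1) (j + 1)) * ψ i (j + 1) ≤ (c + 4) * ψ (i + 1) (j + 1) ∧
      (1 - α (i + 1) (j + 1)) * ψ (i + 2) (j + 1) ≤ (c + 4) * ψ (i + 1) (j + 1) ∧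
      (1 + β (i + 1) (j + 1)) * ψ (i + 1) j ≤ (c + 4) * ψ (i + 1) (j + 1) ∧
      (1 - β (i + 1) (j + 1)) * ψ (i + 1) (j + 2) ≤ (c + 4) * ψ (i + 1) (j + 1) := by
    intro i j hie hje hi hj
    have h0 := hcc i j hie hje hi hj
    obtain ⟨x1, x2, x3⟩ := midStencil_le (x := ψ (i + 1) (j + 1)) ha
      (hα (i + 1) (j + 1) (by omega) (by omega) (by omega) (by omega))
      (hψ i (j + 1) (by omega) (by omega)) (hψ (i + 2) (j + 1) (by omega) (by omega))
    obtain ⟨y1, y2, y3⟩ := midStencil_le (x := ψ (i + 1) (j + 1)) ha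
      (hβ (i + 1) (j + 1) (by omega) (by omega) (by omega) (by omega))
      (hψ (i + 1) j (by omega) (by omega)) (hψ (i + 1) (j + 2) (by omega) (by omega))
    refine ⟨?_, ?_, ?_, ?_, ?_⟩ <;> linarith
  have xedge : ∀ i j, Even i → Even j → i < nx → j + 2 < ny →
      0 < (c + 11 / 2) * ψ (i + 1) (j + 2) ∧
      (1 + α (i + 1) (j + 2)) * ψ i (j + 2) ≤ (c + 11 / 2) * ψ (i + 1) (j + 2) ∧
      (1 - α (i + 1) (j + 2)) * ψ (i + 2) (j + 2) ≤ (c + 11 / 2) * ψ (i + 1) (j + 2) := by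
    intro i j hie hje hi hj
    have h0 := hxe i j hie hje hi hj
    have hje' : Even (j + 2) := hje.add even_two
    obtain ⟨x1, x2, x3⟩ := midStencil_le (x := ψ (i + 1) (j + 2)) ha
      (hα (i + 1) (j + 2) (by omega) (by omega) (by omega) (by omega))
      (hψ i (j + 2) (by omega) (by omega)) (hψ (i + 2) (j + 2) (by omega) (by omega))
    have y := endStencil_le (x := ψ (i + 1) (j + 2)) ha (by linarith) hca'
      (hβ (i + 1) (j + 2) (by omega) (by omega) (by omega) (by omega))
      (hβ (i + 1) (j + 1) (by omega) (by omega) (by omega) (by omega))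
      (hβ (i + 1) (j + 3) (by omega) (by omega) (by omega) (by omega))
      (hψ (i + 1) j (by omega) (by omega)) (hψ (i + 1) (j + 4) (by omega) (by omega))
      (center i j hie hje hi (by omega)).2.2.2.1
      (center i (j + 2) hie hje' hi (by omega)).2.2.2.2
    refine ⟨?_, ?_, ?_⟩ <;> linarith
  have yedge : ∀ i j, Even i → Even j → i + 2 < nx → j < ny →
      0 < (c + 11 / 2) * ψ (i + 2) (j + 1) ∧
      (1 + β (i + 2) (j + 1)) * ψ (i + 2) j ≤ (c + 11 / 2) * ψ (i + 2) (j + 1) ∧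
      (1 - β (i + 2) (j + 1)) * ψ (i + 2) (j + 2) ≤ (c + 11 / 2) * ψ (i + 2) (j + 1) := by
    intro i j hie hje hi hj
    have h0 := hye i j hie hje hi hj
    have hie' : Even (i + 2) := hie.add even_two
    obtain ⟨x1, x2, x3⟩ := midStencil_le (x := ψ (i + 2) (j + 1)) ha
      (hβ (i + 2) (j + 1) (by omega) (by omega) (by omega) (by omega))
      (hψ (i + 2) j (by omega) (by omega)) (hψ (i + 2) (j + 2) (by omega) (by omega))
    have y := endStencil_le (x := ψ (i + 2) (j + 1)) ha (by linarith) hca'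
      (hα (i + 2) (j + 1) (by omega) (by omega) (by omega) (by omega))
      (hα (i + 1) (j + 1) (by omega) (by omega) (by omega) (by omega))
      (hα (i + 3) (j + 1) (by omega) (by omega) (by omega) (by omega))
      (hψ i (j + 1) (by omega) (by omega)) (hψ (i + 4) (j + 1) (by omega) (by omega))
      (center i j hie hje (by omega) hj).2.1
      (center (i + 2) j hie' hje (by omega) hj).2.2.1
    refine ⟨?_, ?_, ?_⟩ <;> linarith
  have knot : ∀ i j, Even i → Even j → i + 2 < nx → j + 2 < ny →
      0 < (c + 7) * ψ (i + 2) (j + 2) := by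
    intro i j hie hje hi hj
    have h0 := hkn i j hie hje hi hj
    have hie' : Even (i + 2) := hie.add even_two
    have hje' : Even (j + 2) := hje.add even_two
    have x := endStencil_le (x := ψ (i + 2) (j + 2)) ha (by linarith) hca
      (hα (i + 2) (j + 2) (by omega) (by omega) (by omega) (by omega))
      (hα (i + 1) (j + 2) (by omega) (by omega) (by omega) (by omega))
      (hα (i + 3) (j + 2) (by omega) (by omega) (by omega) (by omega))
      (hψ i (j + 2) (by omega) (by omega)) (hψ (i + 4) (j + 2) (by omega) (by omega))
      (xedge i j hie hje (by omega) hj).2.1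
      (xedge (i + 2) j hie' hje (by omega) hj).2.2
    have y := endStencil_le (x := ψ (i + 2) (j + 2)) ha (by linarith) hca
      (hβ (i + 2) (j + 2) (by omega) (by omega) (by omega) (by omega))
      (hβ (i + 2) (j + 1) (by omega) (by omega) (by omega) (by omega))
      (hβ (i + 2) (j + 3) (by omega) (by omega) (by omega) (by omega))
      (hψ (i + 2) j (by omega) (by omega)) (hψ (i + 2) (j + 4) (by omega) (by omega))
      (yedge i j hie hje hi (by omega)).2.1
      (yedge i (j + 2) hie hje' hi (by omega)).2.2
    linarith
  rcases Nat.even_or_odd i with hie | hio <;> rcases Nat.even_or_odd j with hje | hjo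
  · obtain ⟨k, rfl, hke, hk⟩ := exists_even_add_two hnx hie hi1 hi
    obtain ⟨l, rfl, hle, hl⟩ := exists_even_add_two hny hje hj1 hj
    exact pos_of_mul_pos_right (knot k l hke hle hk hl) (by linarith)
  · obtain ⟨k, rfl, hke, hk⟩ := exists_even_add_two hnx hie hi1 hi
    obtain ⟨l, rfl, hle, hl⟩ := exists_even_add_one hjo hj
    exact pos_of_mul_pos_right (yedge k l hke hle hk hl).1 (by linarith)
  · obtain ⟨k, rfl, hke, hk⟩ := exists_even_add_one hio hi
    obtain ⟨l, rfl, hle, hl⟩ := exists_even_add_two hny hje hj1 hj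
    exact pos_of_mul_pos_right (xedge k l hke hle hk hl).1 (by linarith)
  · obtain ⟨k, rfl, hke, hk⟩ := exists_even_add_one hio hi
    obtain ⟨l, rfl, hle, hl⟩ := exists_even_add_one hjo hj
    exact pos_of_mul_pos_right (center k l hke hle hk hl).1 (by linarith)

theorem gridVal_eq {nx ny : ℕ} (φ : Fin (nx + 2) → Fin (ny + 2) → ℝ) {i j : ℕ}
    (hi : i < nx + 2) (hj : j < ny + 2) : gridVal nx ny φ i j = φ ⟨i, hi⟩ ⟨j, hj⟩ := by
  simp [gridVal, hi, hj]

/-- Monotonicity of the scheme from the quantitative mesh condition. -/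
theorem nonneg_of_schemeA2D_nonneg {nx ny : ℕ} (hnx : Odd nx) (hny : Odd ny) {h μ Δt a : ℝ}
    (hc : 0 < h ^ 2 / (μ * Δt)) (ha0 : 0 ≤ a) (ha : a < 1 / 4)
    (hca : (h ^ 2 / (μ * Δt) + 11 / 2) * (1 + 2 * a) ≤ 8 * (1 - a ^ 2)) {u v : ℕ → ℕ → ℝ}
    (hu : ∀ i j, 1 ≤ i → i ≤ nx → 1 ≤ j → j ≤ ny → |h * u i j / (2 * μ)| ≤ a)
    (hv : ∀ i j, 1 ≤ i → i ≤ nx → 1 ≤ j → j ≤ ny → |h * v i j / (2 * μ)| ≤ a)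
    {φ : Fin (nx + 2) → Fin (ny + 2) → ℝ}
    (hφ : ∀ I J, 0 ≤ schemeA2D nx ny h μ Δt u v φ I J) (I : Fin (nx + 2)) (J : Fin (ny + 2)) :
    0 ≤ φ I J := by
  obtain ⟨⟨P, Q⟩, hmin⟩ := Finite.exists_min (fun p : Fin (nx + 2) × Fin (ny + 2) => φ p.1 p.2)
  refine le_trans ?_ (hmin (I, J))
  by_contra! hneg
  dsimp only at hneg hmin
  have hcm : h ^ 2 / (μ * Δt) * φ P Q < 0 := mul_neg_of_pos_of_neg hc hneg
  by_cases hb : isBdry nx ny P Q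
  · have := hφ P Q
    simp only [schemeA2D, hb, if_true] at this
    linarith
  have hpos := interior_pos (ψ := fun i j => gridVal nx ny φ i j - φ P Q) hnx hny hc ha0 ha hca
    hu hv ?_ ?_ ?_ ?_ ?_ P Q (by grind [isBdry]) (by grind [isBdry]) (by grind [isBdry])
    (by grind [isBdry])
  · rw [gridVal_eq φ P.2 Q.2] at hpos
    simp at hpos
  · intro i j hi hj
    rw [gridVal_eq φ (by lia) (by lia)]
    exact sub_nonneg.mpr (hmin (_, _))
  · intro i j hie hje hi hj
    have h0 := hφ ⟨i + 1, by lia⟩ ⟨j + 1, by lia⟩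
    have hb' : ¬ isBdry nx ny (i + 1) (j + 1) := by grind [isBdry]
    have ho : Odd (i + 1) := hie.add_one
    have ho' : Odd (j + 1) := hje.add_one
    simp only [schemeA2D, hb', ho, ho', and_self, if_true, if_false, Nat.add_sub_cancel,
      add_assoc, Nat.reduceAdd] at h0
    unfold midStencil
    linear_combination h0 + hcm
  · intro i j hie hje hi hj
    have h0 := hφ ⟨i + 1, by lia⟩ ⟨j + 2, by lia⟩
    have hb' : ¬ isBdry nx ny (i + 1) (j + 2) := by grind [isBdry]
    have ho : Odd (i + 1) := hie.add_one
    have ho' : ¬ Odd (j + 2) := by grind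
    simp only [schemeA2D, hb', ho, ho', and_false, if_true, if_false, Nat.add_sub_cancel,
      add_assoc, Nat.reduceAdd, Nat.reduceSubDiff] at h0
    unfold midStencil endStencil
    linear_combination h0 + hcm
  · intro i j hie hje hi hj
    have h0 := hφ ⟨i + 2, by lia⟩ ⟨j + 1, by lia⟩
    have hb' : ¬ isBdry nx ny (i + 2) (j + 1) := by grind [isBdry]
    have ho : ¬ Odd (i + 2) := by grind
    have ho' : Odd (j + 1) := hje.add_one
    simp only [schemeA2D, hb', ho, ho', false_and, if_true, if_false, Nat.add_sub_cancel,
      add_assoc, Nat.reduceAdd, Nat.reduceSubDiff] at h0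
    unfold midStencil endStencil
    linear_combination h0 + hcm
  · intro i j hie hje hi hj
    have h0 := hφ ⟨i + 2, by lia⟩ ⟨j + 2, by lia⟩
    have hb' : ¬ isBdry nx ny (i + 2) (j + 2) := by grind [isBdry]
    have ho : ¬ Odd (i + 2) := by grind
    have ho' : ¬ Odd (j + 2) := by grind
    simp only [schemeA2D, hb', ho, ho', and_self, if_false, Nat.add_sub_cancel,
      add_assoc, Nat.reduceAdd, Nat.reduceSubDiff] at h0
    unfold endStencil
    linear_combination h0 + hcm

theorem gridVal_add (nx ny : ℕ) (φ χ : Fin (nx + 2) → Fin (ny + 2) → ℝ) (i j : ℕ) :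
    gridVal nx ny (φ + χ) i j = gridVal nx ny φ i j + gridVal nx ny χ i j := by
  unfold gridVal
  split_ifs <;> simp

theorem gridVal_smul (nx ny : ℕ) (r : ℝ) (φ : Fin (nx + 2) → Fin (ny + 2) → ℝ) (i j : ℕ) :
    gridVal nx ny (r • φ) i j = r * gridVal nx ny φ i j := by
  unfold gridVal
  split_ifs <;> simp

/-- The scheme operator as a linear map. -/
noncomputable def schemeA2DLinearMap (nx ny : ℕ) (h μ Δt : ℝ) (u v : ℕ → ℕ → ℝ) :
    (Fin (nx + 2) → Fin (ny + 2) → ℝ) →ₗ[ℝ] (Fin (nx + 2) → Fin (ny + 2) → ℝ) where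
  toFun := schemeA2D nx ny h μ Δt u v
  map_add' φ χ := by
    ext I J
    simp only [schemeA2D, gridVal_add, Pi.add_apply]
    split_ifs <;> ring
  map_smul' r φ := by
    ext I J
    simp only [schemeA2D, gridVal_smul, Pi.smul_apply, smul_eq_mul, RingHom.id_apply]
    split_ifs <;> ring

/-- Theorem 3.8 in the paper (monotonicity of the 2D fourth-order scheme): with
`a = (h/(2μ))·‖(u,v)‖_∞`, if `a < (√201 - 11)/16` and
`Δt·μ/h² ≥ (2a+1)/(5/2 - 11a - 8a²)`, then the scaled 2D fourth-order scheme operator `A`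
(equivalently the unscaled scheme operator `L̄ = (1/c)A`) is bijective and its inverse
maps entrywise-nonnegative arrays to entrywise-nonnegative arrays. -/
theorem schemeA2D_inverse_positive
    (nx ny : ℕ) (hnx : Odd nx) (hny : Odd ny) (hnx3 : 3 ≤ nx) (hny3 : 3 ≤ ny)
    (h μ Δt : ℝ) (hh : 0 < h) (hμ : 0 < μ) (hΔt : 0 < Δt)
    (u v : ℕ → ℕ → ℝ) (m a : ℝ)
    (hm : IsGreatest {x : ℝ | ∃ i j : ℕ, 1 ≤ i ∧ i ≤ nx ∧ 1 ≤ j ∧ j ≤ ny ∧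
      x = max |u i j| |v i j|} m)
    (ha : a = h / (2 * μ) * m)
    (ha' : a < (Real.sqrt 201 - 11) / 16)
    (hdt : Δt * μ / h ^ 2 ≥ (2 * a + 1) / (5 / 2 - 11 * a - 8 * a ^ 2)) :
    Function.Bijective (schemeA2D nx ny h μ Δt u v) ∧
      ∀ φ : Fin (nx + 2) → Fin (ny + 2) → ℝ,
        (∀ I J, 0 ≤ schemeA2D nx ny h μ Δt u v φ I J) → ∀ I J, 0 ≤ φ I J := by
  have hc : 0 < h ^ 2 / (μ * Δt) := by positivity
  have hm_le : ∀ i j, 1 ≤ i → i ≤ nx → 1 ≤ j → j ≤ ny → max |u i j| |v i j| ≤ m :=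
    fun i j h1 h2 h3 h4 => hm.2 ⟨i, j, h1, h2, h3, h4, rfl⟩
  have hscale : 0 < h / (2 * μ) := by positivity
  have hm0 : 0 ≤ m :=
    (abs_nonneg _).trans ((le_max_left _ _).trans (hm_le 1 1 le_rfl (by lia) le_rfl (by lia)))
  have ha0 : 0 ≤ a := ha ▸ mul_nonneg hscale.le hm0
  have hbound : ∀ w : ℝ, |w| ≤ m → |h * w / (2 * μ)| ≤ a := by
    intro w hw
    rw [ha, mul_div_right_comm, abs_mul, abs_of_pos hscale]
    exact mul_le_mul_of_nonneg_left hw hscale.le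
  have hs : 16 * a + 11 < √201 := by linarith
  have hsq : (16 * a + 11) ^ 2 < 201 := (Real.lt_sqrt (by linarith)).mp hs
  have hden : 0 < 5 / 2 - 11 * a - 8 * a ^ 2 := by linarith
  have ha4 : a < 1 / 4 := by nlinarith
  have hca : (h ^ 2 / (μ * Δt) + 11 / 2) * (1 + 2 * a) ≤ 8 * (1 - a ^ 2) := by
    rw [ge_iff_le, div_le_div_iff₀ hden (by positivity)] at hdt
    have : h ^ 2 / (μ * Δt) * (2 * a + 1) ≤ 5 / 2 - 11 * a - 8 * a ^ 2 := by
      rw [div_mul_eq_mul_div, div_le_iff₀ (by positivity)]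
      linarith
    linarith
  have mono : ∀ φ, (∀ I J, 0 ≤ schemeA2D nx ny h μ Δt u v φ I J) → ∀ I J, 0 ≤ φ I J :=
    fun φ => nonneg_of_schemeA2D_nonneg hnx hny hc ha0 ha4 hca
      (fun i j h1 h2 h3 h4 => hbound _ ((le_max_left _ _).trans (hm_le i j h1 h2 h3 h4)))
      (fun i j h1 h2 h3 h4 => hbound _ ((le_max_right _ _).trans (hm_le i j h1 h2 h3 h4)))
  refine ⟨?_, mono⟩
  have hinj : Function.Injective (schemeA2DLinearMap nx ny h μ Δt u v) := by
    rw [injective_iff_map_eq_zero]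
    intro φ hφ
    have hzero : ∀ χ, schemeA2DLinearMap nx ny h μ Δt u v χ = 0 → ∀ I J, 0 ≤ χ I J :=
      fun χ hχ => mono χ fun I J => (congrFun (congrFun hχ I) J).ge
    ext I J
    have h1 := hzero φ hφ I J
    have h2 := hzero (-φ) (by rw [map_neg, hφ, neg_zero]) I J
    simp only [Pi.neg_apply, Pi.zero_apply] at h2 ⊢
    linarith
  exact ⟨hinj, LinearMap.injective_iff_surjective.mp hinj⟩
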